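/- arXiv:2107.05353 — 7 statements merged into one kernel-verified Lean document; each statement's English description precedes it below -/
import Mathlib

section
/- Let A₁,…,Aₙ be finite subsets of ℝ. Then E_{A₁×⋯×Aₙ} = {0,…,|A₁|−1} × ⋯ × {0,…,|Aₙ|−1}. -/
open MvPolynomial

/-- A monomial order on ℕⁿ: a linear order (total, antisymmetric, transitive)
that is a well-order and is compatible with addition. -/
def IsMonomialOrder (n : ℕ) (r : (Fin n → ℕ) → (Fin n → ℕ) → Prop) : Prop :=
  (∀ a b, r a b ∨ r b a) ∧
  (∀ a b, r a b → r b a → a = b) ∧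
  (∀ a b c, r a b → r b c → r a c) ∧
  WellFounded (fun a b => r a b ∧ a ≠ b) ∧
  (∀ a b c, r a b → r (a + c) (b + c))

/-- `e` is the exponent of the leading monomial of `p` w.r.t. the monomial order `r`. -/
def IsLeadMon {n : ℕ} (r : (Fin n → ℕ) → (Fin n → ℕ) → Prop)
    (p : MvPolynomial (Fin n) ℝ) (e : Fin n → ℕ) : Prop :=
  (∃ d ∈ p.support, ⇑d = e) ∧ ∀ d ∈ p.support, r (⇑d) e

/-- `E_A`: the set of exponents `e` such that no (nonzero) polynomial vanishing on `A`
has leading monomial `X^e`. -/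
def ESet {n : ℕ} (r : (Fin n → ℕ) → (Fin n → ℕ) → Prop)
    (A : Set (Fin n → ℝ)) : Set (Fin n → ℕ) :=
  {e | ¬ ∃ p : MvPolynomial (Fin n) ℝ, (∀ a ∈ A, eval a p = 0) ∧ IsLeadMon r p e}

/-- A monomial order refines the componentwise order. -/
theorem IsMonomialOrder.of_le {n : ℕ} {r : (Fin n → ℕ) → (Fin n → ℕ) → Prop}
    (hr : IsMonomialOrder n r) {d e : Fin n → ℕ} (h : d ≤ e) : r d e := by
  obtain ⟨htotal, -, -, hwf, hadd⟩ := hr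
  have zero_le (f : Fin n → ℕ) : r 0 f := by
    by_contra hf
    have hf0 : f ≠ 0 := fun h0 => hf (by simpa [h0] using htotal 0 0)
    refine (wellFounded_iff_isEmpty_descending_chain.1 hwf).elim ⟨fun k => k • f, fun k => ⟨?_, ?_⟩⟩
    · simp only [succ_nsmul']
      simpa only [zero_add] using hadd f 0 (k • f) ((htotal 0 f).resolve_left hf)
    · simp only [succ_nsmul']
      exact fun h => hf0 (add_eq_right.1 h)
  have key := hadd 0 (e - d) d (zero_le _)
  rwa [zero_add, tsub_add_cancel_of_le h] at key

/-- On a node set of cardinality `m + 1` there is a linear functional on functions that kills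
`x ^ k` for `k < m` and takes the value `1` at `x ^ m`. -/
theorem exists_weights_sum_pow {F : Type*} [Field F] {s : Finset F} {m : ℕ} (hs : s.card = m + 1) :
    ∃ w : F → F, ∑ x ∈ s, w x * x ^ m = 1 ∧ ∀ k < m, ∑ x ∈ s, w x * x ^ k = 0 := by
  classical
  have key (k : ℕ) (hk : k ≤ m) :
      ∑ x ∈ s, (∏ y ∈ s.erase x, (x - y))⁻¹ * x ^ k = if m = k then 1 else 0 := by
    have h := Lagrange.coeff_eq_sum (s := s) (v := id) Function.injective_id.injOn
      (P := Polynomial.X ^ k)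
      (by rw [Polynomial.degree_X_pow, hs]; exact_mod_cast Nat.lt_succ_of_le hk)
    rw [hs, Nat.add_sub_cancel, Polynomial.coeff_X_pow] at h
    rw [h]
    simp [div_eq_inv_mul]
  exact ⟨_, by simpa using key m le_rfl, fun k hk => by simpa [hk.ne'] using key k hk.le⟩

/-- If some exponent `e i` is at least the size of `s`, there is a polynomial with leading
coefficient `1` at `e`, all of whose exponents are at most `e`, that vanishes whenever the `i`-th
coordinate lies in `s`. -/
theorem exists_eval_eq_zero_of_card_le {σ F : Type*} [Field F] {s : Finset F} {e : σ →₀ ℕ} {i : σ}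
    (h : s.card ≤ e i) :
    ∃ p : MvPolynomial σ F, (∀ a : σ → F, a i ∈ s → eval a p = 0) ∧ p.coeff e = 1 ∧
      ∀ d ∈ p.support, d ≤ e := by
  classical
  let P : Polynomial F := ∏ x ∈ s, (Polynomial.X - Polynomial.C x)
  have hdeg : P.natDegree = s.card := Polynomial.natDegree_finsetProd_X_sub_C_eq_card s id
  have hmonic : P.Monic := Polynomial.monic_prod_X_sub_C _ s
  let f : σ →₀ ℕ := e - Finsupp.single i s.card
  have hle : Finsupp.single i s.card ≤ e := Finsupp.single_le_iff.2 h
  have hfe : f + Finsupp.single i s.card = e := tsub_add_cancel_of_le hle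
  refine ⟨∑ j ∈ Finset.range (P.natDegree + 1),
    monomial (f + Finsupp.single i j) (P.coeff j), fun a ha => ?_, ?_, fun d hd => ?_⟩
  · have hP : P.eval (a i) = 0 := by
      rw [Polynomial.eval_prod]
      exact Finset.prod_eq_zero ha (by simp)
    have hmon (j : ℕ) : eval a (monomial (f + Finsupp.single i j) (P.coeff j)) =
        eval a (monomial f 1) * (P.coeff j * a i ^ j) := by
      rw [← one_mul (P.coeff j), ← monomial_mul, map_mul]
      simp [eval_monomial]
    rw [map_sum, Finset.sum_congr rfl fun j _ => hmon j, ← Finset.mul_sum,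
      ← Polynomial.eval_eq_sum_range, hP, mul_zero]
  · rw [coeff_sum, Finset.sum_eq_single s.card]
    · rw [hfe, coeff_monomial, if_pos rfl, ← hdeg]
      exact hmonic
    · intro j _ hj
      rw [coeff_monomial, if_neg]
      intro hje
      exact hj (Finsupp.single_injective i (add_left_cancel (hje.trans hfe.symm)))
    · simp [hdeg]
  · obtain ⟨j, hj, hdj⟩ := Finset.mem_biUnion.1 (support_sum hd)
    rw [Finset.mem_singleton.1 (support_monomial_subset hdj), ← hfe]
    gcongr
    have := Finset.mem_range.1 hj
    lia

/-- If every exponent of `p` other than `e` has a coordinate below that of `e`, and `p` vanishes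
on a grid with more than `e i` points in direction `i`, then the coefficient of `e` is zero. -/
theorem coeff_eq_zero_of_eval_eq_zero {σ F : Type*} [Fintype σ] [Field F] {A : σ → Finset F}
    {p : MvPolynomial σ F} {e : σ →₀ ℕ} (hA : ∀ i, e i < (A i).card)
    (hp : ∀ a : σ → F, (∀ i, a i ∈ A i) → eval a p = 0)
    (hsupp : ∀ d ∈ p.support, d ≠ e → ∃ i, d i < e i) : p.coeff e = 0 := by
  classical
  choose B hBA hB using fun i => Finset.exists_subset_card_eq (Nat.succ_le_of_lt (hA i))
  choose w hw_one hw_zero using fun i => exists_weights_sum_pow (hB i)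
  have hzero : ∑ b ∈ Fintype.piFinset B, (∏ i, w i (b i)) * eval b p = 0 :=
    Finset.sum_eq_zero fun b hb => by
      rw [hp b fun i => hBA i (Fintype.mem_piFinset.1 hb i), mul_zero]
  have hswap : ∑ b ∈ Fintype.piFinset B, (∏ i, w i (b i)) * eval b p =
      ∑ d ∈ p.support, p.coeff d * ∏ i, ∑ x ∈ B i, w i x * x ^ d i := by
    simp_rw [eval_eq', Finset.mul_sum, Finset.prod_univ_sum, Finset.mul_sum,
      Finset.prod_mul_distrib]
    rw [Finset.sum_comm]
    refine Finset.sum_congr rfl fun d _ => Finset.sum_congr rfl fun b _ => by ring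
  rw [hswap, Finset.sum_eq_single e] at hzero
  · simpa [hw_one] using hzero
  · intro d hd hde
    obtain ⟨i, hi⟩ := hsupp d hd hde
    rw [Finset.prod_eq_zero (Finset.mem_univ i) (hw_zero i _ hi), mul_zero]
  · intro he
    rw [notMem_support_iff.1 he, zero_mul]

/-- Combinatorial Nullstellensatz:
`E_{A₁×⋯×Aₙ} = {0,…,|A₁|−1} × ⋯ × {0,…,|Aₙ|−1}`. -/
theorem combinatorial_nullstellensatz {n : ℕ}
    (r : (Fin n → ℕ) → (Fin n → ℕ) → Prop) (hr : IsMonomialOrder n r)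
    (A : Fin n → Finset ℝ) :
    ESet r {a : Fin n → ℝ | ∀ i, a i ∈ A i} = {e : Fin n → ℕ | ∀ i, e i < (A i).card} := by
  ext e
  obtain ⟨e, rfl⟩ := Finsupp.equivFunOnFinite.surjective e
  simp only [ESet, Set.mem_ofPred_eq, Finsupp.equivFunOnFinite_apply]
  constructor
  · intro he
    by_contra! hcard
    obtain ⟨i, hi⟩ := hcard
    obtain ⟨p, hp, hcoeff, hsupp⟩ := exists_eval_eq_zero_of_card_le hi
    exact he ⟨p, fun a ha => hp a (ha i), ⟨e, by simp [mem_support_iff, hcoeff], rfl⟩,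
      fun d hd => hr.of_le (hsupp d hd)⟩
  · rintro hcard ⟨p, hp, ⟨d, hd, hde⟩, hlead⟩
    obtain rfl : d = e := DFunLike.coe_injective hde
    refine mem_support_iff.1 hd (coeff_eq_zero_of_eval_eq_zero hcard hp fun c hc hcd => ?_)
    by_contra! hle
    exact hcd (DFunLike.coe_injective (hr.2.1 _ _ (hlead c hc) (hr.of_le hle)))
end

section
/- Let A be a finite lower subset of ℕⁿ, i.e. whenever q ∈ A and p ∈ ℕⁿ satisfies pᵢ ≤ qᵢ for all i, then p ∈ A. Viewing A as a subset of ℝⁿ, one has E_A = A. -/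
open MvPolynomial

/-- The coefficient of `∏ i, Xᵢ ^ d i` in a product of univariate polynomials, the `i`-th one in the
variable `Xᵢ`, is the product of the univariate coefficients. -/
lemma coeff_prod_toMvPolynomial {σ R : Type*} [Fintype σ] [CommSemiring R]
    (q : σ → Polynomial R) (d : σ →₀ ℕ) :
    coeff d (∏ i, (q i).toMvPolynomial i) = ∏ i, (q i).coeff (d i) := by
  classical
  have hq (i : σ) : (q i).toMvPolynomial i =
      ∑ j ∈ Finset.range ((q i).natDegree + 1), C ((q i).coeff j) * X i ^ j := by
    conv_lhs => rw [(q i).as_sum_range_C_mul_X_pow]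
    simp
  have hmon (k : σ → ℕ) : ∏ i, (C ((q i).coeff (k i)) * X i ^ k i : MvPolynomial σ R) =
      monomial (Finsupp.equivFunOnFinite.symm k) (∏ i, (q i).coeff (k i)) := by
    rw [Finset.prod_mul_distrib, ← map_prod, monomial_eq, Finsupp.prod_fintype _ _ (by simp)]
    simp
  simp_rw [hq, Finset.prod_univ_sum, hmon, coeff_sum, coeff_monomial]
  have hd (k : σ → ℕ) : Finsupp.equivFunOnFinite.symm k = d ↔ k = ⇑d := by
    rw [Equiv.symm_apply_eq]; rfl
  simp_rw [hd, Finset.sum_ite_eq', Fintype.mem_piFinset, Finset.mem_range]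
  split_ifs with h
  · rfl
  · push Not at h
    obtain ⟨i, hi⟩ := h
    exact (Finset.prod_eq_zero (Finset.mem_univ i)
      (Polynomial.coeff_eq_zero_of_natDegree_lt (by omega))).symm

/-- The mixed finite difference of order `e` at the origin extracts, up to a nonzero factor, the
coefficient of `X^e` from a polynomial with no other exponent `≥ e`. -/
lemma sum_fwdDiff_eval_eq_coeff {σ R : Type*} [Fintype σ] [DecidableEq σ] [CommRing R]
    (p : MvPolynomial σ R) (e : σ →₀ ℕ) (hp : ∀ d ∈ p.support, e ≤ d → d = e) :
    ∑ k ∈ Fintype.piFinset (fun i => Finset.range (e i + 1)),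
      (∏ i, (((-1 : ℤ) ^ (e i - k i) * (e i).choose (k i) : ℤ) : R)) *
        eval (fun i => (k i : R)) p = coeff e p * ∏ i, ((e i).factorial : R) := by
  have hdiff (d : σ →₀ ℕ) :
      ∑ k ∈ Fintype.piFinset (fun i => Finset.range (e i + 1)),
        (∏ i, (((-1 : ℤ) ^ (e i - k i) * (e i).choose (k i) : ℤ) : R)) *
          ∏ i, (k i : R) ^ d i = ∏ i, (fwdDiff 1)^[e i] (fun x : R => x ^ d i) 0 := by
    simp_rw [fwdDiff_iter_eq_sum_shift, Finset.prod_univ_sum, ← Finset.prod_mul_distrib]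
    simp
  simp_rw [eval_eq', Finset.mul_sum]
  rw [Finset.sum_comm]
  simp_rw [mul_left_comm _ (coeff _ p), ← Finset.mul_sum, hdiff]
  rw [Finset.sum_eq_single e]
  · simp [fwdDiff_iter_eq_factorial]
  · intro d hd hde
    have hnle : ¬ e ≤ d := fun hle => hde (hp d hd hle)
    rw [Finsupp.le_def] at hnle
    push Not at hnle
    obtain ⟨i, hi⟩ := hnle
    rw [Finset.prod_eq_zero (Finset.mem_univ i), mul_zero]
    rw [fwdDiff_iter_pow_eq_zero_of_lt hi, Pi.zero_apply]
  · intro he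
    rw [notMem_support_iff.mp he, zero_mul]

namespace IsMonomialOrder

variable {n : ℕ} {r : (Fin n → ℕ) → (Fin n → ℕ) → Prop}

lemma zero_rel (hr : IsMonomialOrder n r) (a : Fin n → ℕ) : r 0 a := by
  obtain ⟨htot, hanti, -, hwf, hadd⟩ := hr
  obtain ⟨m, -, hm⟩ := hwf.has_min Set.univ ⟨a, trivial⟩
  have hmin (b : Fin n → ℕ) : r m b := by
    rcases htot m b with h | h
    · exact h
    · by_cases hb : b = m
      · exact hb ▸ h
      · exact absurd ⟨h, hb⟩ (hm b trivial)
  have hm0 : m = 0 := by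
    rcases htot m 0 with h | h
    · have hmm : m + m = m := hanti _ _ (by simpa using hadd m 0 m h) (hmin _)
      simpa using hmm
    · exact hanti _ _ (hmin 0) h
  exact hm0 ▸ hmin a

lemma rel_of_le (hr : IsMonomialOrder n r) {a b : Fin n → ℕ} (hab : a ≤ b) : r a b := by
  simpa [tsub_add_cancel_of_le hab] using hr.2.2.2.2 0 (b - a) a (hr.zero_rel _)

end IsMonomialOrder

/-- A finite lower subset `A` of `ℕⁿ`, viewed inside `ℝⁿ`, satisfies `E_A = A`. -/
theorem ESet_of_lowerSet {n : ℕ}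
    (r : (Fin n → ℕ) → (Fin n → ℕ) → Prop) (hr : IsMonomialOrder n r)
    (A : Finset (Fin n → ℕ))
    (hlow : ∀ q ∈ A, ∀ p : Fin n → ℕ, (∀ i, p i ≤ q i) → p ∈ A) :
    ESet r ((fun (e : Fin n → ℕ) (i : Fin n) => (e i : ℝ)) '' ↑A) = ↑A := by
  classical
  ext e
  constructor
  · intro he
    by_contra heA
    refine he ⟨∏ i, (descPochhammer ℝ (e i)).toMvPolynomial i, ?_, ?_, ?_⟩
    · rintro _ ⟨a, ha, rfl⟩
      obtain ⟨i, hi⟩ : ∃ i, a i < e i := by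
        by_contra! hle
        exact heA (hlow a ha e hle)
      rw [map_prod]
      refine Finset.prod_eq_zero (Finset.mem_univ i) ?_
      have heval := RingHom.congr_fun
        (eval_comp_toMvPolynomial (fun j => (a j : ℝ)) i) (descPochhammer ℝ (e i))
      exact heval.trans (descPochhammer_eval_coe_nat_of_lt hi)
    · refine ⟨Finsupp.equivFunOnFinite.symm e, ?_, rfl⟩
      rw [mem_support_iff, coeff_prod_toMvPolynomial]
      refine Finset.prod_ne_zero_iff.mpr fun i _ => ?_
      have hlead := (monic_descPochhammer ℝ (e i)).coeff_natDegree
      rw [descPochhammer_natDegree] at hlead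
      simp [hlead]
    · intro d hd
      rw [mem_support_iff, coeff_prod_toMvPolynomial, Finset.prod_ne_zero_iff] at hd
      refine hr.rel_of_le fun i => ?_
      simpa [descPochhammer_natDegree] using
        Polynomial.le_natDegree_of_ne_zero (hd i (Finset.mem_univ i))
  · rintro he ⟨p, hp, ⟨d, hd, rfl⟩, hlead⟩
    have hsum := sum_fwdDiff_eval_eq_coeff p d fun c hc hle =>
      DFunLike.coe_injective (hr.2.1 _ _ (hlead c hc) (hr.rel_of_le hle))
    rw [Finset.sum_eq_zero] at hsum
    · refine mul_ne_zero (mem_support_iff.mp hd) ?_ hsum.symm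
      exact Finset.prod_ne_zero_iff.mpr fun i _ => Nat.cast_ne_zero.mpr (Nat.factorial_ne_zero _)
    · intro k hk
      have hkA : k ∈ A := hlow d he k fun i =>
        Nat.lt_succ_iff.mp (Finset.mem_range.mp (Fintype.mem_piFinset.mp hk i))
      rw [hp _ ⟨k, hkA, rfl⟩, mul_zero]
end

section
/- For any finite set A ⊆ ℝⁿ, E_A = {sm(f) : f is a nonzero finitely supported function ℝⁿ → ℝ with support contained in A}. -/
open MvPolynomial

/-- The pairing `⟨f, X^e⟩ = Σ_a f(a)·a^e` of a finitely supported function `f : ℝⁿ → ℝ`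
with the monomial `X^e`. -/
noncomputable def pairing {n : ℕ} (f : (Fin n → ℝ) →₀ ℝ) (e : Fin n → ℕ) : ℝ :=
  ∑ a ∈ f.support, f a * ∏ i, a i ^ e i

/-- `e` is the `r`-least exponent with `⟨f, X^e⟩ ≠ 0`, i.e. `e = sm(f)`. -/
def IsSm {n : ℕ} (r : (Fin n → ℕ) → (Fin n → ℕ) → Prop)
    (f : (Fin n → ℝ) →₀ ℝ) (e : Fin n → ℕ) : Prop :=
  pairing f e ≠ 0 ∧ ∀ e' : Fin n → ℕ, pairing f e' ≠ 0 → r e e'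

/-- The pairing extends linearly from monomials to polynomials. -/
theorem sum_mul_eval_eq_sum_coeff_mul_pairing {n : ℕ} (f : (Fin n → ℝ) →₀ ℝ)
    (p : MvPolynomial (Fin n) ℝ) :
    ∑ a ∈ f.support, f a * eval a p = ∑ d ∈ p.support, p.coeff d * pairing f d := by
  simp only [eval_eq', pairing, Finset.mul_sum]
  rw [Finset.sum_comm]
  exact Finset.sum_congr rfl fun _ _ => Finset.sum_congr rfl fun _ _ => by ring

/-- An exponent `sm(f)` with `f` supported in `A` is not the leading exponent of a polynomial
vanishing on `A`. -/
theorem IsSm.mem_ESet {n : ℕ} {r : (Fin n → ℕ) → (Fin n → ℕ) → Prop}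
    (hr : ∀ a b, r a b → r b a → a = b) {A : Set (Fin n → ℝ)} {f : (Fin n → ℝ) →₀ ℝ}
    (hf : ↑f.support ⊆ A) {e : Fin n → ℕ} (he : IsSm r f e) : e ∈ ESet r A := by
  rintro ⟨p, hp, ⟨d, hd, rfl⟩, hlead⟩
  have hsum := sum_mul_eval_eq_sum_coeff_mul_pairing f p
  rw [Finset.sum_eq_zero fun a ha => by rw [hp a (hf ha), mul_zero],
    Finset.sum_eq_single_of_mem d hd fun d' hd' hne => ?_] at hsum
  · exact mul_ne_zero (mem_support_iff.mp hd) he.1 hsum.symm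
  · by_contra h
    exact hne (DFunLike.coe_injective (hr _ _ (hlead d' hd') (he.2 _ (right_ne_zero_of_mul h))))

/-- Every linear functional on the functions on a finite set `A` is, on monomials, the pairing with
a function supported in `A`. -/
theorem exists_pairing_eq {n : ℕ} {A : Set (Fin n → ℝ)} (hA : A.Finite)
    (φ : (A → ℝ) →ₗ[ℝ] ℝ) :
    ∃ f : (Fin n → ℝ) →₀ ℝ, ↑f.support ⊆ A ∧
      ∀ e : Fin n → ℕ, pairing f e = φ fun a => ∏ i, a.1 i ^ e i := by
  classical
  have := hA.fintype
  refine ⟨(Finsupp.equivFunOnFinite.symm fun a : A => φ (Pi.single a 1)).embDomain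
    (Function.Embedding.subtype _), ?_, fun e => ?_⟩
  · intro a ha
    rw [Finsupp.support_embDomain, Finset.mem_coe, Finset.mem_map] at ha
    obtain ⟨b, -, rfl⟩ := ha
    exact b.2
  · change Finsupp.sum _ (fun (a : Fin n → ℝ) c => c * ∏ i, a i ^ e i) = _
    rw [Finsupp.sum_embDomain, Finsupp.sum_fintype _ _ fun _ => zero_mul _,
      LinearMap.pi_apply_eq_sum_univ φ]
    refine Finset.sum_congr rfl fun a _ => ?_
    have hsingle : (fun b => if a = b then (1 : ℝ) else 0) = Pi.single a 1 := by
      ext b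
      simp [Pi.single_apply, eq_comm]
    rw [hsingle, smul_eq_mul, mul_comm]
    rfl

/-- Every exponent in `E_A` is `sm(f)` for some `f` supported in `A`. -/
theorem exists_isSm_of_mem_ESet {n : ℕ} {r : (Fin n → ℕ) → (Fin n → ℕ) → Prop}
    (hr : ∀ a b, r a b ∨ r b a) {A : Set (Fin n → ℝ)} (hA : A.Finite) {e : Fin n → ℕ}
    (he : e ∈ ESet r A) : ∃ f : (Fin n → ℝ) →₀ ℝ, ↑f.support ⊆ A ∧ IsSm r f e := by
  let ev : MvPolynomial (Fin n) ℝ →ₗ[ℝ] (A → ℝ) := LinearMap.pi fun a => (aeval a.1).toLinearMap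
  have hev (d : Fin n → ℕ) :
      ev (monomial (Finsupp.equivFunOnFinite.symm d) 1) = fun a => ∏ i, a.1 i ^ d i := by
    ext a
    simp [ev, aeval_monomial, Finsupp.prod_fintype]
  let e₀ : Fin n →₀ ℕ := Finsupp.equivFunOnFinite.symm e
  let L := restrictSupport ℝ {d : Fin n →₀ ℕ | ¬ r e d}
  have hrefl : r e e := (hr e e).elim id id
  have hnot : ev (monomial e₀ 1) ∉ L.map ev := by
    rintro ⟨q, hq, hqe⟩
    have hq' (d) (hd : q.coeff d ≠ 0) : ¬ r e d :=
      (mem_restrictSupport_iff ℝ).mp hq (mem_support_iff.mpr hd)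
    have hq₀ : q.coeff e₀ = 0 := by
      by_contra h
      exact hq' e₀ h hrefl
    refine he ⟨monomial e₀ 1 - q, fun a ha => ?_, ⟨e₀, ?_, rfl⟩, fun d hd => ?_⟩
    · have := congrFun hqe ⟨a, ha⟩
      simp only [ev, LinearMap.pi_apply, AlgHom.toLinearMap_apply, aeval_eq_eval] at this
      rw [map_sub, this, sub_self]
    · simp [hq₀]
    · by_cases hd₀ : d = e₀
      · subst hd₀
        exact hrefl
      · rw [mem_support_iff, coeff_sub, coeff_monomial, if_neg (Ne.symm hd₀), zero_sub,
          neg_ne_zero] at hd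
        exact (hr d e).resolve_right (hq' d hd)
  obtain ⟨φ, hφ, hker⟩ := Submodule.exists_le_ker_of_notMem hnot
  obtain ⟨f, hf, hpair⟩ := exists_pairing_eq hA φ
  refine ⟨f, hf, ?_, fun e' he' => ?_⟩
  · rwa [hpair e, ← hev e]
  · by_contra h
    refine he' ?_
    rw [hpair e', ← hev e']
    exact hker (Submodule.mem_map_of_mem ((monomial_mem_restrictSupport ℝ).mpr (.inl h)))

/-- For a finite set `A ⊆ ℝⁿ`,
`E_A = {sm(f) : f ≠ 0 finitely supported with support contained in A}`. -/
theorem ESet_eq_sm_image {n : ℕ}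
    (r : (Fin n → ℕ) → (Fin n → ℕ) → Prop) (hr : IsMonomialOrder n r)
    (A : Set (Fin n → ℝ)) (hA : A.Finite) :
    ESet r A = {e : Fin n → ℕ |
      ∃ f : (Fin n → ℝ) →₀ ℝ, f ≠ 0 ∧ ↑f.support ⊆ A ∧ IsSm r f e} := by
  obtain ⟨htotal, hantisymm, -⟩ := hr
  refine Set.Subset.antisymm (fun e he => ?_) ?_
  · obtain ⟨f, hf, hsm⟩ := exists_isSm_of_mem_ESet htotal hA he
    refine ⟨f, ?_, hf, hsm⟩
    rintro rfl
    exact hsm.1 (by simp [pairing])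
  · rintro e ⟨f, -, hf, hsm⟩
    exact hsm.mem_ESet hantisymm hf
end

section
/- Let f, g : ℝⁿ → ℝ be nonzero finitely supported functions. Then the convolution f∗g is nonzero and sm(f∗g) = sm(f) + sm(g). -/
/-- The convolution `(f∗g)(c) = Σ_{a+b=c} f(a)·g(b)` of finitely supported
functions `ℝⁿ → ℝ`. -/
noncomputable def conv {n : ℕ} (f g : (Fin n → ℝ) →₀ ℝ) : (Fin n → ℝ) →₀ ℝ :=
  f.sum fun a fa => g.sum fun b gb => Finsupp.single (a + b) (fa * gb)

theorem pairing_eq_sum {n : ℕ} (f : (Fin n → ℝ) →₀ ℝ) (e : Fin n → ℕ) :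
    pairing f e = f.sum fun a c => c * ∏ i, a i ^ e i := rfl

/-- Pairing a convolution with a monomial is given by the binomial expansion of `(a + b)^e`. -/
theorem pairing_conv {n : ℕ} (f g : (Fin n → ℝ) →₀ ℝ) (e : Fin n → ℕ) :
    pairing (conv f g) e = ∑ k ∈ Fintype.piFinset fun i => Finset.range (e i + 1),
      (∏ i, ((e i).choose (k i) : ℝ)) * (pairing f k * pairing g (e - k)) := by
  have h : pairing (conv f g) e =
      ∑ a ∈ f.support, ∑ b ∈ g.support, f a * g b * ∏ i, (a i + b i) ^ e i := by
    rw [pairing_eq_sum, conv, Finsupp.sum_sum_index (by simp) (fun _ _ _ => add_mul _ _ _)]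
    refine Finset.sum_congr rfl fun a _ => ?_
    beta_reduce
    rw [Finsupp.sum_sum_index (by simp) (fun _ _ _ => add_mul _ _ _)]
    refine Finset.sum_congr rfl fun b _ => ?_
    exact Finsupp.sum_single_index (zero_mul _)
  have hbinom (a b : Fin n → ℝ) : ∏ i, (a i + b i) ^ e i =
      ∑ k ∈ Fintype.piFinset fun i => Finset.range (e i + 1),
        (∏ i, a i ^ k i) * (∏ i, b i ^ (e - k) i) * ∏ i, ((e i).choose (k i) : ℝ) := by
    simp_rw [add_pow, Finset.prod_univ_sum, Finset.prod_mul_distrib, Pi.sub_apply]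
  simp_rw [h, hbinom, pairing, Finset.sum_mul_sum, Finset.mul_sum]
  symm
  rw [Finset.sum_comm]
  refine Finset.sum_congr rfl fun a _ => ?_
  rw [Finset.sum_comm]
  refine Finset.sum_congr rfl fun b _ => Finset.sum_congr rfl fun k _ => ?_
  ring

/-- For nonzero finitely supported `f, g : ℝⁿ → ℝ`, the convolution `f∗g` is
nonzero and `sm(f∗g) = sm(f) + sm(g)`. -/
theorem sm_conv {n : ℕ}
    (r : (Fin n → ℕ) → (Fin n → ℕ) → Prop) (hr : IsMonomialOrder n r)
    (f g : (Fin n → ℝ) →₀ ℝ) (hf : f ≠ 0) (hg : g ≠ 0)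
    (ef eg : Fin n → ℕ) (hef : IsSm r f ef) (heg : IsSm r g eg) :
    conv f g ≠ 0 ∧ IsSm r (conv f g) (ef + eg) := by
  obtain ⟨-, hanti, htrans, -, hadd⟩ := hr
  have hadd' (a b c : Fin n → ℕ) (h : r a b) : r (c + a) (c + b) := by
    simpa only [add_comm c] using hadd a b c h
  have hlower (e : Fin n → ℕ) (he : pairing (conv f g) e ≠ 0) : r (ef + eg) e := by
    rw [pairing_conv] at he
    obtain ⟨k, hk, hne⟩ := Finset.exists_ne_zero_of_sum_ne_zero he
    have hke : k ≤ e := fun i =>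
      Nat.lt_succ_iff.mp (Finset.mem_range.mp (Fintype.mem_piFinset.mp hk i))
    have hfg := right_ne_zero_of_mul hne
    have h := htrans _ _ _ (hadd _ _ eg (hef.2 k (left_ne_zero_of_mul hfg)))
      (hadd' _ _ k (heg.2 (e - k) (right_ne_zero_of_mul hfg)))
    rwa [add_tsub_cancel_of_le hke] at h
  have hleast : pairing (conv f g) (ef + eg) ≠ 0 := by
    rw [pairing_conv, Finset.sum_eq_single ef]
    · rw [add_tsub_cancel_left]
      refine mul_ne_zero (Finset.prod_ne_zero_iff.mpr fun i _ => ?_) (mul_ne_zero hef.1 heg.1)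
      exact Nat.cast_ne_zero.mpr (Nat.choose_pos (Nat.le_add_right _ _)).ne'
    · intro k hk hkef
      by_contra hne
      have hke : k ≤ ef + eg := fun i =>
        Nat.lt_succ_iff.mp (Finset.mem_range.mp (Fintype.mem_piFinset.mp hk i))
      have hfg := right_ne_zero_of_mul hne
      have h₁ := hadd _ _ eg (hef.2 k (left_ne_zero_of_mul hfg))
      have h₂ := hadd' _ _ k (heg.2 (ef + eg - k) (right_ne_zero_of_mul hfg))
      rw [add_tsub_cancel_of_le hke] at h₂
      exact hkef (add_right_cancel (hanti _ _ h₂ h₁))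
    · intro h
      exact absurd (Fintype.mem_piFinset.mpr fun i =>
        Finset.mem_range.mpr (Nat.lt_succ_iff.mpr (Nat.le_add_right _ _))) h
  refine ⟨fun h => hleast ?_, hleast, hlower⟩
  simp [h, pairing]
end

section
/- For any two finite sets A, B ⊆ ℝⁿ, one has E_A + E_B ⊆ E_{A+B}, where A + B = {a + b : a ∈ A, b ∈ B} is the Minkowski sum (and likewise for subsets of ℕⁿ). -/
open MvPolynomial

open Finset.HasAntidiagonal in
/-- The multivariate binomial theorem. -/
theorem prod_add_pow_eq_sum_antidiagonal {σ R : Type*} [Fintype σ] [DecidableEq σ]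
    [CommSemiring R] (x y : σ → R) (g : σ →₀ ℕ) :
    ∏ i, (x i + y i) ^ g i = ∑ m ∈ antidiagonal g,
      ((∏ i, (g i).choose (m.1 i) : ℕ) : R) * (∏ i, x i ^ m.1 i) * ∏ i, y i ^ m.2 i := by
  simp_rw [fun i => (Commute.all (x i) (y i)).add_pow' (g i), Finset.prod_univ_sum]
  refine Finset.sum_bij'
    (fun u _ => (Finsupp.equivFunOnFinite.symm fun i => (u i).1,
      Finsupp.equivFunOnFinite.symm fun i => (u i).2))
    (fun m _ i => (m.1 i, m.2 i)) ?_ ?_ ?_ ?_ ?_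
  · intro u hu
    rw [mem_antidiagonal]
    ext i
    simpa using Fintype.mem_piFinset.1 hu i
  · intro m hm
    rw [Fintype.mem_piFinset]
    intro i
    simpa using DFunLike.congr_fun (mem_antidiagonal.1 hm) i
  · intro u _
    simp
  · intro m _
    ext <;> simp
  · intro u _
    simp [nsmul_eq_mul, Finset.prod_mul_distrib, mul_assoc]

section MonomialOrder

variable {n : ℕ} {r : (Fin n → ℕ) → (Fin n → ℕ) → Prop}

theorem IsMonomialOrder.eq_of_add_le_add (hr : IsMonomialOrder n r) {a b c d : Fin n → ℕ}
    (hac : r a c) (hbd : r b d) (h : r (c + d) (a + b)) : a = c ∧ b = d := by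
  obtain ⟨-, antisymm, trans, -, add⟩ := hr
  have hab : r (a + b) (c + b) := add _ _ _ hac
  have hcd : r (c + b) (c + d) := by simpa only [add_comm] using add _ _ c hbd
  exact ⟨add_right_cancel (antisymm _ _ hab (trans _ _ _ hcd h)),
    add_left_cancel (antisymm _ _ hcd (trans _ _ _ h hab))⟩

/-- Exponents in `ESet r A` are detected by a linear functional that vanishes on the polynomials
vanishing on `A` and on all smaller monomials. -/
theorem exists_functional_of_mem_ESet (hr : IsMonomialOrder n r) {A : Set (Fin n → ℝ)}
    {e : Fin n →₀ ℕ} (he : ⇑e ∈ ESet r A) :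
    ∃ φ : MvPolynomial (Fin n) ℝ →ₗ[ℝ] ℝ,
      (∀ p, (∀ a ∈ A, eval a p = 0) → φ p = 0) ∧
      (∀ d : Fin n →₀ ℕ, φ (monomial d 1) ≠ 0 → r e d) ∧ φ (monomial e 1) ≠ 0 := by
  obtain ⟨total, -, -, -, -⟩ := hr
  let I : Submodule ℝ (MvPolynomial (Fin n) ℝ) := (vanishingIdeal ℝ A).restrictScalars ℝ
  let L : Submodule ℝ (MvPolynomial (Fin n) ℝ) := restrictSupport ℝ {d | ¬ r e d}
  have hI : ∀ p, p ∈ I ↔ ∀ a ∈ A, eval a p = 0 := by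
    intro p
    simp [I, mem_vanishingIdeal_iff, aeval_eq_eval]
  have hL : ∀ p, p ∈ L ↔ ∀ d ∈ p.support, ¬ r e d := by
    intro p
    simp only [L, mem_restrictSupport_iff]
    rfl
  have hree : r e e := (total e e).elim id id
  have hmem : monomial e 1 ∉ I ⊔ L := by
    intro h
    obtain ⟨p, hp, q, hq, hpq⟩ := Submodule.mem_sup.1 h
    have hcoeff : ∀ d, coeff d p + coeff d q = if e = d then 1 else 0 := by
      intro d
      rw [← coeff_add, hpq, coeff_monomial]
    refine he ⟨p, (hI p).1 hp, ⟨e, ?_, rfl⟩, fun d hd => ?_⟩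
    · have hqe : coeff e q = 0 := by
        by_contra hne
        exact (hL q).1 hq e (mem_support_iff.2 hne) hree
      have := hcoeff e
      rw [hqe, if_pos rfl, add_zero] at this
      simp [mem_support_iff, this]
    · by_cases hde : e = d
      · exact hde ▸ hree
      · have hdq : d ∈ q.support := by
          rw [mem_support_iff] at hd ⊢
          intro h0
          have := hcoeff d
          rw [h0, if_neg hde, add_zero] at this
          exact hd this
        exact (total _ _).resolve_right ((hL q).1 hq d hdq)
  obtain ⟨φ, hφ, hle⟩ := Submodule.exists_le_ker_of_notMem hmem
  refine ⟨φ, fun p hp => hle (Submodule.mem_sup_left ((hI p).2 hp)), fun d hd => ?_, hφ⟩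
  by_contra hed
  refine hd (hle (Submodule.mem_sup_right ((hL _).2 fun d' hd' => ?_)))
  rwa [Finset.mem_singleton.1 (support_monomial_subset hd')]

end MonomialOrder

section Convolution

variable {σ R : Type*} [Fintype σ] [DecidableEq σ] [CommRing R]

/-- The polynomial in `X` obtained by applying `φ` to `p(X + Y)`, seen as a polynomial in `Y`. -/
noncomputable def convolve (φ : MvPolynomial σ R →ₗ[R] R) (p : MvPolynomial σ R) :
    MvPolynomial σ R :=
  ∑ g ∈ p.support, ∑ m ∈ Finset.HasAntidiagonal.antidiagonal g,
    monomial m.1 (coeff g p * (∏ i, (g i).choose (m.1 i) : ℕ) * φ (monomial m.2 1))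

theorem eval_convolve (φ : MvPolynomial σ R →ₗ[R] R) (p : MvPolynomial σ R) (a : σ → R) :
    ∃ q : MvPolynomial σ R, (∀ b, eval b q = eval (a + b) p) ∧ eval a (convolve φ p) = φ q := by
  refine ⟨∑ g ∈ p.support, ∑ m ∈ Finset.HasAntidiagonal.antidiagonal g,
    (coeff g p * (∏ i, (g i).choose (m.1 i) : ℕ) * ∏ i, a i ^ m.1 i) • monomial m.2 1,
    fun b => ?_, ?_⟩
  · rw [eval_eq' (a + b) p]
    simp only [Pi.add_apply, prod_add_pow_eq_sum_antidiagonal, map_sum, smul_eval, eval_monomial,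
      Finset.mul_sum, one_mul, Finsupp.prod_pow, mul_assoc]
  · simp only [convolve, map_sum, map_smul, eval_monomial, Finsupp.prod_pow, smul_eq_mul]
    refine Finset.sum_congr rfl fun g _ => Finset.sum_congr rfl fun m _ => ?_
    ring

theorem coeff_convolve (φ : MvPolynomial σ R →ₗ[R] R) (p : MvPolynomial σ R) (h : σ →₀ ℕ) :
    coeff h (convolve φ p) = ∑ g ∈ p.support, ∑ m ∈ Finset.HasAntidiagonal.antidiagonal g,
      if m.1 = h then coeff g p * (∏ i, (g i).choose (m.1 i) : ℕ) * φ (monomial m.2 1) else 0 := by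
  simp only [convolve, coeff_sum, coeff_monomial]

end Convolution

open Pointwise in
/-- For finite sets `A, B ⊆ ℝⁿ` one has `E_A + E_B ⊆ E_{A+B}` (Minkowski sums). -/
theorem ESet_add_subset {n : ℕ}
    (r : (Fin n → ℕ) → (Fin n → ℕ) → Prop) (hr : IsMonomialOrder n r)
    (A B : Set (Fin n → ℝ)) (hA : A.Finite) (hB : B.Finite) :
    ESet r A + ESet r B ⊆ ESet r (A + B) := by
  rintro _ ⟨e', he, f', hf, rfl⟩ ⟨p, hp, ⟨d, hd, hdef⟩, hlead⟩
  obtain ⟨e, rfl⟩ : ∃ e : Fin n →₀ ℕ, ⇑e = e' := ⟨Finsupp.equivFunOnFinite.symm e', rfl⟩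
  obtain ⟨f, rfl⟩ : ∃ f : Fin n →₀ ℕ, ⇑f = f' := ⟨Finsupp.equivFunOnFinite.symm f', rfl⟩
  obtain rfl : d = e + f := DFunLike.coe_injective hdef
  obtain ⟨φ, hφB, hφlt, hφf⟩ := exists_functional_of_mem_ESet hr hf
  have hlead' : ∀ m ∈ p.support, ∀ h k : Fin n →₀ ℕ, h + k = m → r (⇑h + ⇑k) (⇑e + ⇑f) := by
    rintro _ hm h k rfl
    exact hlead _ hm
  refine he ⟨convolve φ p, fun a ha => ?_, ⟨e, ?_, rfl⟩, fun h hh => ?_⟩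
  · obtain ⟨q, hq, hφq⟩ := eval_convolve φ p a
    rw [hφq]
    exact hφB q fun b hb => (hq b).trans (hp _ (Set.add_mem_add ha hb))
  · have key : ∀ g ∈ p.support, ∀ m ∈ Finset.HasAntidiagonal.antidiagonal g, m.1 = e →
        φ (monomial m.2 1) ≠ 0 → m = (e, f) := by
      rintro g hg ⟨h, k⟩ hm rfl hk
      have hle := hlead' g hg h k (Finset.HasAntidiagonal.mem_antidiagonal.1 hm)
      obtain ⟨-, hfk⟩ := hr.eq_of_add_le_add ((hr.1 h h).elim id id) (hφlt k hk) hle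
      rw [DFunLike.coe_injective hfk]
    rw [mem_support_iff, coeff_convolve, Finset.sum_eq_single (e + f),
      Finset.sum_eq_single (e, f), if_pos rfl]
    · refine mul_ne_zero (mul_ne_zero (mem_support_iff.1 hd) ?_) hφf
      rw [Nat.cast_ne_zero, Finset.prod_ne_zero_iff]
      exact fun i _ => (Nat.choose_pos (by simp)).ne'
    · intro m hm hne
      split_ifs with hme
      · rw [not_ne_iff.1 (mt (key _ hd m hm hme) hne), mul_zero]
      · rfl
    · exact fun hn => (hn (by rw [Finset.HasAntidiagonal.mem_antidiagonal])).elim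
    · intro g hg hne
      refine Finset.sum_eq_zero fun m hm => ?_
      split_ifs with hme
      · rw [not_ne_iff.1 (mt (key g hg m hm hme) fun h => hne ?_), mul_zero]
        rw [← Finset.HasAntidiagonal.mem_antidiagonal.1 hm, h]
      · rfl
    · exact fun hn => absurd hd hn
  · rw [mem_support_iff, coeff_convolve] at hh
    obtain ⟨g, hg, hh⟩ := Finset.exists_ne_zero_of_sum_ne_zero hh
    obtain ⟨⟨h', k⟩, hm, hh⟩ := Finset.exists_ne_zero_of_sum_ne_zero hh
    obtain ⟨rfl, -⟩ := ite_ne_right_iff.1 hh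
    rw [if_pos rfl] at hh
    refine (hr.1 h' e).elim id fun heh => ?_
    have hle := hlead' g hg h' k (Finset.HasAntidiagonal.mem_antidiagonal.1 hm)
    obtain ⟨heq, -⟩ := hr.eq_of_add_le_add heh (hφlt k (right_ne_zero_of_mul hh)) hle
    rwa [← heq] at heh ⊢
end

section
/- Let n ≥ 2 and equip ℕⁿ with the lexicographic monomial order with X₁ < ⋯ < Xₙ (e < e′ iff eᵢ < e′ᵢ at the largest index i where e and e′ differ), and equip ℕ^{n−1} with the corresponding lexicographic order with X₂ < ⋯ < Xₙ. Let A ⊆ ℝⁿ be a finite set, and for a₁ ∈ ℝ let B(a₁) = {(a₂,…,aₙ) : (a₁,a₂,…,aₙ) ∈ A} ⊆ ℝ^{n−1}. Then e = (e₁,…,eₙ) ∈ E_A if and only if the number of a₁ ∈ ℝ with (e₂,…,eₙ) ∈ E_{B(a₁)} is greater than e₁, where E_{B(a₁)} is computed with the restricted lexicographic order. -/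
open MvPolynomial

/-- The lexicographic monomial order with `X₁ < ⋯ < Xₘ`:
`e ≤ e'` iff `e = e'` or `e i < e' i` at the largest index `i` where they differ. -/
def lexLe {m : ℕ} (e e' : Fin m → ℕ) : Prop :=
  e = e' ∨ ∃ i : Fin m, e i < e' i ∧ ∀ j : Fin m, i < j → e j = e' j

section LexFiber

/-- Comparing two exponents in the lexicographic order amounts to comparing their tails first,
and their `0`-th entries in case of a tie. -/
lemma lexLe_iff_tail {n : ℕ} (a b : Fin (n + 1) → ℕ) :
    lexLe a b ↔ lexLe (Fin.tail a) (Fin.tail b) ∧ (Fin.tail a = Fin.tail b → a 0 ≤ b 0) := by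
  constructor
  · rintro (rfl | ⟨i, hi, hj⟩)
    · exact ⟨Or.inl rfl, fun _ => le_rfl⟩
    · induction i using Fin.cases with
      | zero => exact ⟨Or.inl (funext fun j => hj j.succ j.succ_pos), fun _ => hi.le⟩
      | succ i =>
        exact ⟨Or.inr ⟨i, hi, fun j h => hj j.succ (Fin.succ_lt_succ_iff.2 h)⟩,
          fun h => absurd (congrFun h i) hi.ne⟩
  · rintro ⟨h | ⟨i, hi, hj⟩, h0⟩
    · rcases (h0 h).lt_or_eq with h' | h'
      · refine Or.inr ⟨0, h', fun j hj => ?_⟩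
        obtain ⟨k, rfl⟩ := Fin.exists_succ_eq.2 hj.ne'
        exact congrFun h k
      · rw [← Fin.cons_self_tail a, ← Fin.cons_self_tail b, h, h']
        exact Or.inl rfl
    · refine Or.inr ⟨i.succ, hi, fun j h => ?_⟩
      obtain ⟨k, rfl⟩ := Fin.exists_succ_eq.2 (lt_of_le_of_lt (Fin.zero_le _) h).ne'
      exact hj k (Fin.succ_lt_succ_iff.1 h)

/-- An exponent lies outside `E_A` iff it is the leading exponent of a polynomial
with leading coefficient `1` vanishing on `A`. -/
lemma notMem_ESet_iff {n : ℕ} (r : (Fin n → ℕ) → (Fin n → ℕ) → Prop) (A : Set (Fin n → ℝ))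
    (m : Fin n →₀ ℕ) :
    ⇑m ∉ ESet r A ↔ ∃ p : MvPolynomial (Fin n) ℝ, (∀ a ∈ A, eval a p = 0) ∧
      coeff m p = 1 ∧ ∀ d, coeff d p ≠ 0 → r d m := by
  simp only [ESet, Set.mem_ofPred_eq, not_not, IsLeadMon, mem_support_iff]
  constructor
  · rintro ⟨p, hp, ⟨d, hd, hdm⟩, h⟩
    obtain rfl : d = m := DFunLike.coe_injective hdm
    refine ⟨C (coeff d p)⁻¹ * p, fun a ha => by simp [hp a ha], by simp [hd], fun d' hd' => h d' ?_⟩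
    rw [coeff_C_mul] at hd'
    exact right_ne_zero_of_mul hd'
  · rintro ⟨p, hp, h1, h⟩
    exact ⟨p, hp, ⟨m, by simp [h1], rfl⟩, h⟩

/-- No exponent lies in `E_∅`. -/
lemma nonempty_of_mem_ESet {n : ℕ} {A : Set (Fin n → ℝ)} {e : Fin n → ℕ}
    (h : e ∈ ESet lexLe A) : A.Nonempty := by
  rw [Set.nonempty_iff_ne_empty]
  rintro rfl
  refine (notMem_ESet_iff lexLe ∅ (Finsupp.equivFunOnFinite.symm e)).2
    ⟨monomial (Finsupp.equivFunOnFinite.symm e) 1, by simp, by simp, fun d hd => ?_⟩ h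
  rw [coeff_monomial] at hd
  rw [← (ite_ne_right_iff.1 hd).1]
  exact Or.inl rfl

/-- The coefficient of a product of a polynomial in the `0`-th variable and a polynomial
in the remaining variables. -/
lemma coeff_toMvPolynomial_mul_rename_succ {R : Type*} [CommSemiring R] {n : ℕ}
    (g : Polynomial R) (r : MvPolynomial (Fin n) R) (d : Fin (n + 1) →₀ ℕ) :
    coeff d (g.toMvPolynomial 0 * rename Fin.succ r) = g.coeff (d 0) * coeff d.tail r := by
  have hg : finSuccEquiv R n (g.toMvPolynomial 0) = g.map C := by
    induction g using Polynomial.induction_on' with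
    | add p q hp hq => simp [hp, hq]
    | monomial k a =>
      simp [← Polynomial.C_mul_X_pow_eq_monomial, finSuccEquiv_apply]
  have hr : finSuccEquiv R n (rename Fin.succ r) = Polynomial.C r := by
    induction r using MvPolynomial.induction_on with
    | C a => simp [finSuccEquiv_apply]
    | add p q hp hq => simp [hp, hq]
    | mul_X p i hp => simp [hp, finSuccEquiv_X_succ]
  rw [← d.cons_tail, ← finSuccEquiv_coeff_coeff, map_mul, hg, hr, Polynomial.coeff_mul_C,
    Polynomial.coeff_map, coeff_C_mul]
  simp

/-- Specializing the `0`-th variable turns coefficients into values of univariate polynomials. -/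
lemma exists_polynomial_coeff_eval_finSuccEquiv {R : Type*} [CommSemiring R] {n : ℕ}
    (p : MvPolynomial (Fin (n + 1)) R) (m : Fin n →₀ ℕ) :
    ∃ c : Polynomial R, (∀ i, c.coeff i = coeff (m.cons i) p) ∧
      ∀ t, coeff m ((finSuccEquiv R n p).eval (C t)) = c.eval t := by
  refine ⟨∑ i ∈ Finset.range ((finSuccEquiv R n p).natDegree + 1),
    Polynomial.monomial i (coeff (m.cons i) p), fun i => ?_, fun t => ?_⟩
  · simp only [Polynomial.finsetSum_coeff, Polynomial.coeff_monomial, Finset.sum_ite_eq',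
      Finset.mem_range, ite_eq_left_iff]
    intro hi
    rw [← finSuccEquiv_coeff_coeff, Polynomial.coeff_eq_zero_of_natDegree_lt (by omega), coeff_zero]
  · rw [Polynomial.eval_finsetSum, Polynomial.eval_eq_sum_range, coeff_sum]
    refine Finset.sum_congr rfl fun i _ => ?_
    rw [Polynomial.eval_monomial, ← C_pow, mul_comm, coeff_C_mul, finSuccEquiv_coeff_coeff,
      mul_comm]

variable {n : ℕ} {A : Set (Fin (n + 1) → ℝ)}

lemma finite_setOf_mem_ESet_fiber (hA : A.Finite) (f : Fin n → ℕ) :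
    {t : ℝ | f ∈ ESet lexLe {b : Fin n → ℝ | Fin.cons t b ∈ A}}.Finite := by
  refine (hA.image fun a => a 0).subset fun t ht => ?_
  obtain ⟨b, hb⟩ := nonempty_of_mem_ESet ht
  exact ⟨_, hb, rfl⟩

lemma ncard_fiber_le_of_notMem_ESet (hA : A.Finite) {e : Fin (n + 1) →₀ ℕ}
    (he : ⇑e ∉ ESet lexLe A) :
    {t : ℝ | ⇑e.tail ∈ ESet lexLe {b : Fin n → ℝ | Fin.cons t b ∈ A}}.ncard ≤ e 0 := by
  obtain ⟨p, hp, hp1, hlead⟩ := (notMem_ESet_iff _ _ _).1 he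
  have hcons (i : ℕ) (d : Fin n →₀ ℕ) (h : coeff (d.cons i) p ≠ 0) :
      lexLe d e.tail ∧ (d = e.tail → i ≤ e 0) := by
    have := (lexLe_iff_tail _ _).1 (hlead _ h)
    exact ⟨this.1, fun hd => this.2 (by subst hd; rfl)⟩
  obtain ⟨c, hc, hceval⟩ := exists_polynomial_coeff_eval_finSuccEquiv p e.tail
  have hc0 : c ≠ 0 := by
    rintro rfl
    simpa [hp1] using hc (e 0)
  have hdeg : c.natDegree ≤ e 0 := by
    refine (hcons _ _ ?_).2 rfl
    rw [← hc]
    exact Polynomial.leadingCoeff_ne_zero.2 hc0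
  rw [Set.ncard_eq_toFinset_card _ (finite_setOf_mem_ESet_fiber hA _)]
  by_contra! hlt
  refine hc0 (Polynomial.eq_zero_of_natDegree_lt_card_of_eval_eq_zero' c _ (fun t ht => ?_)
    (hdeg.trans_lt hlt))
  rw [Set.Finite.mem_toFinset] at ht
  by_contra hct
  refine ht ⟨(finSuccEquiv ℝ n p).eval (C t), fun b hb => ?_, ⟨e.tail, ?_, rfl⟩, fun d hd => ?_⟩
  · rw [eval_polynomial_eval_finSuccEquiv, eval_C]
    exact hp _ hb
  · rwa [mem_support_iff, hceval]
  · obtain ⟨c', hc', hceval'⟩ := exists_polynomial_coeff_eval_finSuccEquiv p d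
    rw [mem_support_iff, hceval'] at hd
    obtain ⟨i, hi⟩ : ∃ i, c'.coeff i ≠ 0 := by
      by_contra! h
      exact hd (by simp [Polynomial.ext (q := 0) (by simpa using h)])
    exact (hcons i d (hc' i ▸ hi)).1

lemma notMem_ESet_of_ncard_fiber_le (hA : A.Finite) {e : Fin (n + 1) →₀ ℕ}
    (he : {t : ℝ | ⇑e.tail ∈ ESet lexLe {b : Fin n → ℝ | Fin.cons t b ∈ A}}.ncard ≤ e 0) :
    ⇑e ∉ ESet lexLe A := by
  classical
  have hSfin := finite_setOf_mem_ESet_fiber hA ⇑e.tail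
  rw [Set.ncard_eq_toFinset_card _ hSfin] at he
  set S := hSfin.toFinset with hS
  have hex (t : ℝ) (ht : t ∉ S) := (notMem_ESet_iff lexLe
    {b : Fin n → ℝ | Fin.cons t b ∈ A} e.tail).1 (by simpa [hS] using ht)
  choose! q hq hq1 hqlead using hex
  obtain ⟨t₀, ht₀⟩ := Infinite.exists_notMem_finset S
  set U := insert t₀ ((hA.image fun a => a 0).toFinset \ S) with hU
  have hUS (t : ℝ) (ht : t ∈ U) : t ∉ S := by
    rcases Finset.mem_insert.1 ht with rfl | h
    · exact ht₀
    · exact (Finset.mem_sdiff.1 h).2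
  -- The univariate factor: monic of degree `e 0` and vanishing on `S`.
  set h : Polynomial ℝ := Polynomial.X ^ (e 0 - S.card) *
    ∏ s ∈ S, (Polynomial.X - Polynomial.C s) with hh
  have hmonic : h.Monic := (Polynomial.monic_X_pow _).mul
    (Polynomial.monic_prod_of_monic _ _ fun s _ => Polynomial.monic_X_sub_C s)
  have hdeg : h.natDegree = e 0 := by
    rw [hh, (Polynomial.monic_X_pow _).natDegree_mul
      (Polynomial.monic_prod_of_monic _ _ fun s _ => Polynomial.monic_X_sub_C s),
      Polynomial.natDegree_X_pow, Polynomial.natDegree_finsetProd_X_sub_C_eq_card]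
    omega
  have hsum (k : ℕ) : ∑ t ∈ U, (Lagrange.basis U id t * h).coeff k = h.coeff k := by
    rw [← Polynomial.finsetSum_coeff, ← Finset.sum_mul,
      Lagrange.sum_basis Function.injective_id.injOn ⟨t₀, Finset.mem_insert_self _ _⟩, one_mul]
  have hcoeff (d : Fin (n + 1) →₀ ℕ) : coeff d (∑ t ∈ U,
      (Lagrange.basis U id t * h).toMvPolynomial 0 * rename Fin.succ (q t)) =
      ∑ t ∈ U, (Lagrange.basis U id t * h).coeff (d 0) * coeff d.tail (q t) := by
    simp_rw [coeff_sum, coeff_toMvPolynomial_mul_rename_succ]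
  have htail (d : Fin (n + 1) →₀ ℕ) (hd : d.tail = e.tail) :
      ∑ t ∈ U, (Lagrange.basis U id t * h).coeff (d 0) * coeff d.tail (q t) = h.coeff (d 0) := by
    rw [← hsum, hd]
    exact Finset.sum_congr rfl fun t ht => by rw [hq1 t (hUS t ht), mul_one]
  refine (notMem_ESet_iff _ _ _).2 ⟨∑ t ∈ U,
    (Lagrange.basis U id t * h).toMvPolynomial 0 * rename Fin.succ (q t), fun a ha => ?_, ?_,
    fun d hd => ?_⟩
  · rw [map_sum]
    refine Finset.sum_eq_zero fun t ht => ?_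
    rw [map_mul, eval_toMvPolynomial, eval_rename, Polynomial.eval_mul]
    by_cases haS : a 0 ∈ S
    · have : h.eval (a 0) = 0 := by
        rw [hh, Polynomial.eval_mul, Polynomial.eval_prod,
          Finset.prod_eq_zero haS (by simp), mul_zero]
      rw [this, mul_zero, zero_mul]
    · have haU : a 0 ∈ U := Finset.mem_insert_of_mem
        (Finset.mem_sdiff.2 ⟨(Set.Finite.mem_toFinset _).2 ⟨a, ha, rfl⟩, haS⟩)
      by_cases hta : t = a 0
      · have : eval (a ∘ Fin.succ) (q t) = 0 := by
          refine hq t (hUS t ht) _ ?_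
          rw [hta]
          exact (Fin.cons_self_tail a).symm ▸ ha
        rw [this, mul_zero]
      · have := Lagrange.eval_basis_of_ne (v := (id : ℝ → ℝ)) hta haU
        rw [id] at this
        rw [this, zero_mul, zero_mul]
  · rw [hcoeff, htail e rfl, ← hdeg]
    exact hmonic
  · rw [hcoeff] at hd
    refine (lexLe_iff_tail _ _).2 ⟨?_, fun hde => ?_⟩
    · obtain ⟨t, ht, hne⟩ := Finset.exists_ne_zero_of_sum_ne_zero hd
      exact hqlead t (hUS t ht) d.tail (right_ne_zero_of_mul hne)
    · rw [htail d (DFunLike.coe_injective hde)] at hd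
      exact hdeg ▸ Polynomial.le_natDegree_of_ne_zero hd

end LexFiber

/-- For a finite set `A ⊆ ℝⁿ` (`n ≥ 2`) and the lexicographic monomial order,
`e ∈ E_A` iff the number of `a₁ ∈ ℝ` with `(e₂,…,eₙ) ∈ E_{B(a₁)}` exceeds `e₁`,
where `B(a₁)` is the fiber of `A` over the first coordinate. -/
theorem ESet_lex_fiber {n : ℕ} (hn : 1 ≤ n)
    (A : Set (Fin (n + 1) → ℝ)) (hA : A.Finite) (e : Fin (n + 1) → ℕ) :
    e ∈ ESet lexLe A ↔
      e 0 < Set.ncard {t : ℝ |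
        Fin.tail e ∈ ESet lexLe {b : Fin n → ℝ | Fin.cons t b ∈ A}} := by
  have hiff := Iff.intro (ncard_fiber_le_of_notMem_ESet hA (e := Finsupp.equivFunOnFinite.symm e))
    (notMem_ESet_of_ncard_fiber_le hA)
  rw [← not_iff_not, not_lt]
  exact hiff
end

section
/- Let f : ℤⁿ → ℝ be a nonzero finitely supported function. Then |sm(f)| equals the order of vanishing at (1,…,1) of the Laurent polynomial π_f = Σ_a f(a)X^a; concretely, |sm(f)| is the largest natural number d such that for every e ∈ ℕⁿ with |e| < d one has Σ_{a ∈ ℤⁿ} f(a) · ∏_{i=1}^{n} ∏_{j=0}^{e_i−1} (a_i − j) = 0 (these sums being the iterated partial derivatives ∂^e π_f evaluated at (1,…,1)). -/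
/-- The pairing `⟨f, X^e⟩ = Σ_{a ∈ ℤⁿ} f(a)·a^e`. -/
noncomputable def pairingZ {n : ℕ} (f : (Fin n → ℤ) →₀ ℝ) (e : Fin n → ℕ) : ℝ :=
  ∑ a ∈ f.support, f a * ∏ i, (a i : ℝ) ^ e i

/-- `e` is the `r`-least exponent with `⟨f, X^e⟩ ≠ 0`, i.e. `e = sm(f)`. -/
def IsSmZ {n : ℕ} (r : (Fin n → ℕ) → (Fin n → ℕ) → Prop)
    (f : (Fin n → ℤ) →₀ ℝ) (e : Fin n → ℕ) : Prop :=
  pairingZ f e ≠ 0 ∧ ∀ e' : Fin n → ℕ, pairingZ f e' ≠ 0 → r e e'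

/-- `∂^e π_f (1,…,1) = Σ_{a ∈ ℤⁿ} f(a)·∏ᵢ ∏_{j<eᵢ} (aᵢ − j)`, the iterated partial
derivative of the Laurent polynomial `π_f = Σ_a f(a)X^a` evaluated at `(1,…,1)`. -/
noncomputable def laurentDeriv {n : ℕ} (f : (Fin n → ℤ) →₀ ℝ) (e : Fin n → ℕ) : ℝ :=
  ∑ a ∈ f.support, f a * ∏ i, ∏ j ∈ Finset.range (e i), ((a i : ℝ) - (j : ℝ))

/-- Falling factorials are triangular combinations of powers. -/
theorem exists_descFactorial_eq_sum_pow (k : ℕ) : ∃ c : ℕ → ℝ, ∀ x : ℝ,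
    ∏ j ∈ Finset.range k, (x - (j : ℝ)) = ∑ j ∈ Finset.range (k + 1), c j * x ^ j := by
  refine ⟨(descPochhammer ℝ k).coeff, fun x => ?_⟩
  rw [← descPochhammer_eval_eq_prod_range, Polynomial.eval_eq_sum_range,
    descPochhammer_natDegree]

/-- Powers are triangular combinations of falling factorials. -/
theorem exists_pow_eq_sum_descFactorial (k : ℕ) : ∃ c : ℕ → ℝ, ∀ x : ℝ,
    x ^ k = ∑ j ∈ Finset.range (k + 1), c j * ∏ i ∈ Finset.range j, (x - (i : ℝ)) := by
  induction k with
  | zero => exact ⟨fun _ => 1, fun x => by simp⟩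
  | succ k ih =>
    obtain ⟨c, hc⟩ := ih
    refine ⟨fun j => (if j = 0 then 0 else c (j - 1)) + if j < k + 1 then j * c j else 0,
      fun x => ?_⟩
    simp only [add_mul, Finset.sum_add_distrib]
    rw [Finset.sum_range_succ', Finset.sum_range_succ (n := k + 1), pow_succ, hc x,
      Finset.sum_mul]
    simp only [Nat.add_eq_zero_iff, one_ne_zero, and_false, if_false, Nat.add_sub_cancel,
      if_true, zero_mul, add_zero, lt_irrefl]
    rw [← Finset.sum_add_distrib]
    refine Finset.sum_congr rfl fun j hj => ?_
    rw [if_pos (Finset.mem_range.mp hj), Finset.prod_range_succ]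
    ring

/-- If a functional kills all products `∏ i, u (e i)` of total degree `< d`, and each `v k` is
a combination of `u 0, …, u k`, then it kills all products `∏ i, v (e i)` of total degree `< d`. -/
theorem sum_mul_prod_eq_zero_of_triangular {n : ℕ} (u v : ℕ → ℝ → ℝ)
    (huv : ∀ k, ∃ c : ℕ → ℝ, ∀ x, v k x = ∑ j ∈ Finset.range (k + 1), c j * u j x)
    (f : (Fin n → ℤ) →₀ ℝ) (d : ℕ)
    (hu : ∀ e : Fin n → ℕ, (∑ i, e i) < d →
      ∑ a ∈ f.support, f a * ∏ i, u (e i) (a i : ℝ) = 0)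
    (e : Fin n → ℕ) (he : (∑ i, e i) < d) :
    ∑ a ∈ f.support, f a * ∏ i, v (e i) (a i : ℝ) = 0 := by
  choose c hc using huv
  simp only [hc, Finset.prod_univ_sum, Finset.prod_mul_distrib, Finset.mul_sum]
  rw [Finset.sum_comm]
  refine Finset.sum_eq_zero fun g hg => ?_
  have hge : (∑ i, g i) ≤ ∑ i, e i := Finset.sum_le_sum fun i _ =>
    Nat.lt_succ_iff.mp (Finset.mem_range.mp (Fintype.mem_piFinset.mp hg i))
  simp only [mul_left_comm (f _)]
  rw [← Finset.mul_sum, hu g (hge.trans_lt he), mul_zero]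

/-- For a nonzero finitely supported `f : ℤⁿ → ℝ` and a monomial order refining total
degree, `|sm(f)|` is the largest `d` such that all iterated partial derivatives of
`π_f` of total order `< d` vanish at `(1,…,1)`, i.e. the order of vanishing of `π_f`
at `(1,…,1)`. -/
theorem sm_eq_order_of_vanishing {n : ℕ}
    (r : (Fin n → ℕ) → (Fin n → ℕ) → Prop) (hr : IsMonomialOrder n r)
    (hdeg : ∀ e e' : Fin n → ℕ, (∑ i, e i) < (∑ i, e' i) → r e e' ∧ e ≠ e')
    (f : (Fin n → ℤ) →₀ ℝ) (hf : f ≠ 0) (s : Fin n → ℕ) (hs : IsSmZ r f s) :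
    IsGreatest {d : ℕ | ∀ e : Fin n → ℕ, (∑ i, e i) < d → laurentDeriv f e = 0}
      (∑ i, s i) := by
  have pairing_zero : ∀ e : Fin n → ℕ, (∑ i, e i) < (∑ i, s i) → pairingZ f e = 0 := by
    intro e he
    by_contra h
    obtain ⟨hes, hne⟩ := hdeg e s he
    exact hne (hr.2.1 e s hes (hs.2 e h))
  constructor
  · exact sum_mul_prod_eq_zero_of_triangular (fun k x => x ^ k)
      (fun k x => ∏ j ∈ Finset.range k, (x - (j : ℝ)))
      exists_descFactorial_eq_sum_pow f _ pairing_zero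
  · intro d hd
    by_contra! hlt
    exact hs.1 (sum_mul_prod_eq_zero_of_triangular
      (fun k x => ∏ j ∈ Finset.range k, (x - (j : ℝ))) (fun k x => x ^ k)
      exists_pow_eq_sum_descFactorial f d hd s hlt)
end
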